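/- arXiv:1105.2463 — 4 statements merged into one kernel-verified Lean document; each statement's English description precedes it below -/
import Mathlib

section
/- Let r ≥ 2 and t ≥ 1 be integers. Then the strict asymptotic density with respect to the sup-norm of the set U_t of t-visible elements of ℤ^r equals 1/(t^r ζ(r)); that is, lim_{n→∞} #{z ∈ ℤ^r : ‖z‖_∞ ≤ n and gcd(z) = t} / #{z ∈ ℤ^r : ‖z‖_∞ ≤ n} = 1/(t^r ζ(r)), where ζ is the Riemann zeta function. -/
open Filter

/-- The Riemann zeta function at a natural number argument, ζ(r) = Σ_{m≥1} m^{-r}. -/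
noncomputable def zetaR (r : ℕ) : ℝ := ∑' m : ℕ, 1 / ((m : ℝ) + 1) ^ r

open scoped ArithmeticFunction.Moebius

lemma zetaR_eq_riemannZeta {r : ℕ} (hr : 2 ≤ r) : (zetaR r : ℂ) = riemannZeta r := by
  have h := zeta_eq_tsum_one_div_nat_add_one_cpow (s := (r : ℂ)) (by simp; lia)
  rw [h, zetaR, Complex.ofReal_tsum]
  refine tsum_congr fun n => ?_
  rw [Complex.cpow_natCast]
  push_cast
  rfl

lemma tsum_moebius_div_pow {r : ℕ} (hr : 2 ≤ r) :
    ∑' d : ℕ, (μ d : ℝ) / (d : ℝ) ^ r = 1 / zetaR r := by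
  have hs : 1 < (r : ℂ).re := by simp; lia
  have h := LSeries_one_mul_Lseries_moebius hs
  rw [LSeries_one_eq_riemannZeta hs, ← zetaR_eq_riemannZeta hr] at h
  have h' : LSeries (fun n => (μ n : ℂ)) r = ((∑' d : ℕ, (μ d : ℝ) / (d : ℝ) ^ r : ℝ) : ℂ) := by
    rw [LSeries, Complex.ofReal_tsum]
    refine tsum_congr fun n => ?_
    rw [LSeries.term_of_ne_zero' (by norm_cast; lia), Complex.cpow_natCast]
    push_cast
    rfl
  rw [h', ← Complex.ofReal_mul] at h
  exact eq_one_div_of_mul_eq_one_right (Complex.ofReal_eq_one.mp h)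

lemma card_Icc_filter_dvd (n k : ℕ) (hk : 0 < k) :
    ((Finset.Icc (-n : ℤ) n).filter (fun x => (k : ℤ) ∣ x)).card = 2 * (n / k) + 1 := by
  have hk' : (0 : ℤ) < k := by exact_mod_cast hk
  have h : (Finset.Icc (-n : ℤ) n).filter (fun x => (k : ℤ) ∣ x) =
      (Finset.Icc (-(n / k : ℕ) : ℤ) (n / k : ℕ)).image (fun x => (k : ℤ) * x) := by
    ext x
    simp only [Finset.mem_filter, Finset.mem_Icc, Finset.mem_image]
    constructor
    · rintro ⟨⟨h1, h2⟩, y, rfl⟩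
      refine ⟨y, ⟨?_, ?_⟩, rfl⟩
      · push_cast
        rw [neg_le, Int.le_ediv_iff_mul_le hk']
        linarith
      · push_cast
        rw [Int.le_ediv_iff_mul_le hk']
        linarith
    · rintro ⟨y, ⟨h1, h2⟩, rfl⟩
      push_cast at h1 h2
      rw [neg_le, Int.le_ediv_iff_mul_le hk'] at h1
      rw [Int.le_ediv_iff_mul_le hk'] at h2
      exact ⟨⟨by linarith, by linarith⟩, dvd_mul_right _ _⟩
  rw [h, Finset.card_image_of_injective _ (mul_right_injective₀ hk'.ne'), Int.card_Icc]
  generalize n / k = q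
  lia

/-- The integer vectors of sup-norm at most `n`. -/
noncomputable def supBox (r n : ℕ) : Finset (Fin r → ℤ) :=
  Fintype.piFinset fun _ => Finset.Icc (-n : ℤ) n

lemma mem_supBox {r n : ℕ} {z : Fin r → ℤ} : z ∈ supBox r n ↔ ∀ i, |z i| ≤ (n : ℤ) := by
  simp [supBox, abs_le]

lemma card_supBox_filter_dvd (r n k : ℕ) (hk : 0 < k) :
    ((supBox r n).filter (fun z => ∀ i, (k : ℤ) ∣ z i)).card = (2 * (n / k) + 1) ^ r := by
  have h : (supBox r n).filter (fun z => ∀ i, (k : ℤ) ∣ z i) =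
      Fintype.piFinset fun _ => (Finset.Icc (-n : ℤ) n).filter (fun x => (k : ℤ) ∣ x) := by
    ext z
    simp only [supBox, Finset.mem_filter, Fintype.mem_piFinset]
    exact forall_and.symm
  rw [h, Fintype.card_piFinset]
  simp [card_Icc_filter_dvd n k hk]

lemma card_supBox (r n : ℕ) : (supBox r n).card = (2 * n + 1) ^ r := by
  simpa using card_supBox_filter_dvd r n 1 one_pos

lemma card_supBox_erase_zero_filter_dvd (r n k : ℕ) (hk : 0 < k) :
    ((((supBox r n).erase 0).filter (fun z => ∀ i, (k : ℤ) ∣ z i)).card : ℤ) =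
      (2 * (n / k : ℕ) + 1) ^ r - 1 := by
  rw [Finset.filter_erase, Finset.card_erase_of_mem (by simp [mem_supBox]),
    card_supBox_filter_dvd r n k hk, Nat.cast_pred (by positivity)]
  push_cast
  rfl

lemma sum_Icc_moebius_ite_mul_dvd {g n t : ℕ} (hg : 0 < g) (hgn : g ≤ n) (ht : 0 < t) :
    ∑ d ∈ Finset.Icc 1 n, (if t * d ∣ g then μ d else 0) = if g = t then 1 else 0 := by
  by_cases htg : t ∣ g
  · obtain ⟨e, rfl⟩ := htg
    have he : 0 < e := pos_of_mul_pos_right hg ht.le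
    have hen : e ≤ n := (Nat.le_mul_of_pos_left e ht).trans hgn
    simp only [Nat.mul_dvd_mul_iff_left ht]
    rw [← Finset.sum_filter]
    have hdiv : (Finset.Icc 1 n).filter (· ∣ e) = e.divisors := by
      ext d
      simp only [Finset.mem_filter, Finset.mem_Icc, Nat.mem_divisors]
      constructor
      · rintro ⟨-, h⟩
        exact ⟨h, he.ne'⟩
      · rintro ⟨h, -⟩
        exact ⟨⟨Nat.pos_of_dvd_of_pos h he, (Nat.le_of_dvd he h).trans hen⟩, h⟩
    rw [hdiv, ← ArithmeticFunction.coe_mul_zeta_apply, ArithmeticFunction.moebius_mul_coe_zeta,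
      ArithmeticFunction.one_apply]
    simp [ht.ne']
  · rw [if_neg (by rintro rfl; exact htg dvd_rfl)]
    exact Finset.sum_eq_zero fun d _ => if_neg fun h => htg (dvd_of_mul_right_dvd h)

lemma natAbs_gcd_univ_pos_and_le {r n : ℕ} {z : Fin r → ℤ} (hz : z ∈ (supBox r n).erase 0) :
    0 < (Finset.univ.gcd z).natAbs ∧ (Finset.univ.gcd z).natAbs ≤ n := by
  obtain ⟨h0, hz⟩ := Finset.mem_erase.mp hz
  obtain ⟨i, hi⟩ := Function.ne_iff.mp h0
  have hd : (Finset.univ.gcd z).natAbs ∣ (z i).natAbs :=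
    Int.natAbs_dvd_natAbs.mpr (Finset.gcd_dvd (Finset.mem_univ i))
  have hpos : 0 < (z i).natAbs := Int.natAbs_pos.mpr hi
  have hle := mem_supBox.mp hz i
  rw [Int.abs_eq_natAbs] at hle
  exact ⟨Nat.pos_of_dvd_of_pos hd hpos, (Nat.le_of_dvd hpos hd).trans (by exact_mod_cast hle)⟩

lemma sum_Icc_moebius_ite_forall_dvd {r n t : ℕ} (ht : 0 < t) {z : Fin r → ℤ}
    (hz : z ∈ (supBox r n).erase 0) :
    ∑ d ∈ Finset.Icc 1 n, (if ∀ i, ((t * d : ℕ) : ℤ) ∣ z i then μ d else 0) =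
      if Finset.univ.gcd z = (t : ℤ) then 1 else 0 := by
  obtain ⟨hpos, hle⟩ := natAbs_gcd_univ_pos_and_le hz
  have hnn : ((Finset.univ.gcd z).natAbs : ℤ) = Finset.univ.gcd z := by
    rw [Int.natCast_natAbs, Int.abs_eq_normalize, Finset.normalize_gcd]
  have h := sum_Icc_moebius_ite_mul_dvd hpos hle ht
  have hdvd (k : ℕ) : k ∣ (Finset.univ.gcd z).natAbs ↔ ∀ i, (k : ℤ) ∣ z i := by
    rw [← Int.natCast_dvd_natCast, hnn, Finset.dvd_gcd_iff]
    simp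
  simp only [hdvd] at h
  rw [h]
  refine if_congr ?_ rfl rfl
  rw [← Int.natCast_inj, hnn]

lemma ncard_visible_eq_sum (r n t : ℕ) (ht : 0 < t) :
    ({z : Fin r → ℤ | (∀ i, |z i| ≤ (n : ℤ)) ∧ Finset.univ.gcd z = (t : ℤ)}.ncard : ℤ) =
      ∑ d ∈ Finset.Icc 1 n, μ d * ((2 * (n / (t * d) : ℕ) + 1) ^ r - 1) := by
  have hset : {z : Fin r → ℤ | (∀ i, |z i| ≤ (n : ℤ)) ∧ Finset.univ.gcd z = (t : ℤ)} =
      (((supBox r n).erase 0).filter (fun z => Finset.univ.gcd z = (t : ℤ)) : Finset _) := by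
    ext z
    simp only [Set.mem_ofPred_eq, Finset.coe_filter, Finset.mem_erase, mem_supBox]
    constructor
    · rintro ⟨h1, h2⟩
      refine ⟨⟨?_, h1⟩, h2⟩
      rintro rfl
      have h0 : Finset.univ.gcd (0 : Fin r → ℤ) = 0 := Finset.gcd_eq_zero_iff.mpr (by simp)
      rw [h0] at h2
      lia
    · rintro ⟨⟨-, h1⟩, h2⟩
      exact ⟨h1, h2⟩
  rw [hset, Set.ncard_coe_finset, Finset.card_filter, Nat.cast_sum]
  simp only [Nat.cast_ite, Nat.cast_one, Nat.cast_zero]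
  rw [← Finset.sum_congr rfl fun z hz => sum_Icc_moebius_ite_forall_dvd ht hz, Finset.sum_comm]
  refine Finset.sum_congr rfl fun d hd => ?_
  rw [← card_supBox_erase_zero_filter_dvd r n (t * d) (Nat.mul_pos ht (Finset.mem_Icc.mp hd).1),
    ← Finset.sum_filter, Finset.sum_const, nsmul_eq_mul, mul_comm]

lemma ncard_visible_div_eq_tsum (r n t : ℕ) (ht : 0 < t) :
    ({z : Fin r → ℤ | (∀ i, |z i| ≤ (n : ℤ)) ∧ Finset.univ.gcd z = (t : ℤ)}.ncard : ℝ) /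
        ({z : Fin r → ℤ | ∀ i, |z i| ≤ (n : ℤ)}.ncard : ℝ) =
      ∑' d : ℕ, (μ d : ℝ) *
        (((2 * (n / (t * d) : ℕ) + 1) ^ r - 1) / (2 * n + 1) ^ r) := by
  have hset : {z : Fin r → ℤ | ∀ i, |z i| ≤ (n : ℤ)} = (supBox r n : Set _) := by
    ext z
    simp [mem_supBox]
  have h := congrArg (Int.cast : ℤ → ℝ) (ncard_visible_eq_sum r n t ht)
  push_cast at h
  rw [hset, Set.ncard_coe_finset, card_supBox, h, Finset.sum_div, tsum_eq_sum (s := Finset.Icc 1 n)]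
  · push_cast
    exact Finset.sum_congr rfl fun d _ => mul_div_assoc _ _ _
  · intro d hd
    rcases Nat.eq_zero_or_pos d with rfl | hd0
    · simp
    · have hdn : n < d := by
        by_contra! hcon
        exact hd (Finset.mem_Icc.mpr ⟨hd0, hcon⟩)
      rw [Nat.div_eq_of_lt (hdn.trans_le (Nat.le_mul_of_pos_left d ht))]
      simp

lemma tendsto_two_mul_div_add_one_div (k : ℕ) (hk : 0 < k) :
    Tendsto (fun n : ℕ => (2 * ((n / k : ℕ) : ℝ) + 1) / (2 * n + 1)) atTop (nhds (1 / k)) := by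
  have hk' : (0 : ℝ) < k := by exact_mod_cast hk
  have hlim : Tendsto (fun n : ℕ => 1 / ((n : ℝ) + 1)) atTop (nhds 0) :=
    tendsto_one_div_add_atTop_nhds_zero_nat
  refine tendsto_iff_dist_tendsto_zero.mpr (squeeze_zero (fun _ => dist_nonneg) (fun n => ?_) hlim)
  have hn : (n : ℝ) = k * (n / k : ℕ) + (n % k : ℕ) := by exact_mod_cast (Nat.div_add_mod n k).symm
  have hmod : ((n % k : ℕ) : ℝ) + 1 ≤ k := by exact_mod_cast Nat.mod_lt n hk
  have hmod0 : (0 : ℝ) ≤ (n % k : ℕ) := Nat.cast_nonneg _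
  have hn0 : (0 : ℝ) ≤ n := Nat.cast_nonneg _
  have heq : (2 * ((n / k : ℕ) : ℝ) + 1) / (2 * n + 1) - 1 / k =
      (k - 2 * (n % k : ℕ) - 1) / (k * (2 * n + 1)) := by
    rw [div_sub_div _ _ (by positivity) hk'.ne', mul_comm (k : ℝ) (2 * n + 1)]
    congr 1
    linear_combination (-2 : ℝ) * hn
  rw [Real.dist_eq, heq, abs_div, abs_of_pos (by positivity : (0 : ℝ) < k * (2 * n + 1))]
  calc |(k : ℝ) - 2 * (n % k : ℕ) - 1| / (k * (2 * n + 1)) ≤ k / (k * (2 * n + 1)) := by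
        gcongr
        rw [abs_le]
        constructor <;> linarith
    _ = 1 / (2 * n + 1) := by field_simp
    _ ≤ 1 / (n + 1) := by
        gcongr
        linarith

lemma tendsto_moebius_mul_term {r t : ℕ} (hr : r ≠ 0) (ht : 0 < t) (d : ℕ) :
    Tendsto (fun n : ℕ => (μ d : ℝ) *
        (((2 * (n / (t * d) : ℕ) + 1) ^ r - 1) / (2 * n + 1) ^ r)) atTop
      (nhds ((1 / (t : ℝ) ^ r) * ((μ d : ℝ) / (d : ℝ) ^ r))) := by
  rcases Nat.eq_zero_or_pos d with rfl | hd
  · simp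
  have h1 := (tendsto_two_mul_div_add_one_div (t * d) (Nat.mul_pos ht hd)).pow r
  have h2 : Tendsto (fun n : ℕ => (1 : ℝ) / (2 * n + 1)) atTop (nhds 0) := by
    refine tendsto_const_nhds.div_atTop (tendsto_atTop_add_const_right _ _ ?_)
    exact tendsto_natCast_atTop_atTop.const_mul_atTop two_pos
  have h3 := ((h1.sub (h2.pow r)).const_mul (μ d : ℝ))
  convert h3 using 2
  · simp only [div_pow, one_pow, sub_div]
  · rw [zero_pow hr]
    push_cast
    rw [div_pow, mul_pow, one_pow, sub_zero]
    ring

lemma norm_moebius_mul_term_le {r t : ℕ} (hr : r ≠ 0) (ht : 0 < t) (n d : ℕ) :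
    ‖(μ d : ℝ) * (((2 * (n / (t * d) : ℕ) + 1) ^ r - 1) / (2 * n + 1) ^ r)‖ ≤
      2 ^ r * (1 / (d : ℝ) ^ r) := by
  rcases Nat.eq_zero_or_pos d with rfl | hd
  · simp [hr]
  have hμ : |(μ d : ℝ)| ≤ 1 := by exact_mod_cast ArithmeticFunction.abs_moebius_le_one
  have hd' : (0 : ℝ) < d := by exact_mod_cast hd
  have hq : ((n / (t * d) : ℕ) : ℝ) * d ≤ n := by
    have h : n / (t * d) * d ≤ n :=
      (Nat.mul_le_mul_left _ (Nat.le_mul_of_pos_left d ht)).trans (Nat.div_mul_le_self _ _)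
    exact_mod_cast h
  generalize n / (t * d) = q at hq ⊢
  have hone : (1 : ℝ) ≤ (2 * q + 1) ^ r := one_le_pow₀ (by linarith [Nat.cast_nonneg (α := ℝ) q])
  have hnn : (0 : ℝ) ≤ ((2 * q + 1) ^ r - 1) / (2 * n + 1) ^ r :=
    div_nonneg (by linarith) (by positivity)
  rw [norm_mul, Real.norm_eq_abs, Real.norm_of_nonneg hnn]
  refine (mul_le_of_le_one_left hnn hμ).trans ?_
  rcases Nat.eq_zero_or_pos q with rfl | hq0
  · simp only [Nat.cast_zero, mul_zero, zero_add, one_pow, sub_self, zero_div]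
    positivity
  have hq1 : (1 : ℝ) ≤ q := by exact_mod_cast hq0
  calc ((2 * (q : ℝ) + 1) ^ r - 1) / (2 * n + 1) ^ r
      ≤ (2 * (q : ℝ) + 1) ^ r / (2 * n + 1) ^ r := by
        gcongr
        linarith
    _ = ((2 * (q : ℝ) + 1) / (2 * n + 1)) ^ r := (div_pow _ _ _).symm
    _ ≤ (2 / d) ^ r := by
        gcongr ?_ ^ r
        rw [div_le_div_iff₀ (by positivity) hd']
        nlinarith
    _ = 2 ^ r * (1 / (d : ℝ) ^ r) := by rw [div_pow, mul_one_div]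

/-- The strict asymptotic density, with respect to the sup-norm, of the set of
`t`-visible elements of `ℤ^r` (those whose coordinates have gcd exactly `t`)
equals `1 / (t^r ζ(r))`. -/
theorem stmt_0 (r t : ℕ) (hr : 2 ≤ r) (ht : 1 ≤ t) :
    Tendsto (fun n : ℕ =>
      (({z : Fin r → ℤ | (∀ i, |z i| ≤ (n : ℤ)) ∧ Finset.univ.gcd z = (t : ℤ)}.ncard : ℝ)) /
        ({z : Fin r → ℤ | ∀ i, |z i| ≤ (n : ℤ)}.ncard : ℝ))
      atTop (nhds (1 / ((t : ℝ) ^ r * zetaR r))) := by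
  have hr0 : r ≠ 0 := by lia
  have hlim : 1 / ((t : ℝ) ^ r * zetaR r) =
      ∑' d : ℕ, (1 / (t : ℝ) ^ r) * ((μ d : ℝ) / (d : ℝ) ^ r) := by
    rw [tsum_mul_left, tsum_moebius_div_pow hr, one_div_mul_one_div]
  simp only [ncard_visible_div_eq_tsum r _ t ht]
  rw [hlim]
  exact tendsto_tsum_of_dominated_convergence
    ((Real.summable_one_div_nat_pow.mpr (by lia)).mul_left (2 ^ r))
    (tendsto_moebius_mul_term hr0 ht)
    (Eventually.of_forall fun n => norm_moebius_mul_term_le hr0 ht n)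
end

section
/- Let F and G be groups whose abelianizations are free abelian of finite rank, with abelianization map ab_F : F → ℤ^n for F. If f ∈ F satisfies gcd(ab_F(f)) = 1, then for every element g ∈ G there exists a group homomorphism φ : F → G such that φ(f) = g. -/
/-- Let `F`, `G` be groups whose abelianizations are free abelian of finite ranks `n`, `k`,
with abelianization maps `abF : F → ℤ^n` and `abG : G → ℤ^k` (surjective homomorphisms whose
kernels are the commutator subgroups). If `f ∈ F` is visible, i.e. `gcd(abF f) = 1`, then
every element `g ∈ G` is the image of `f` under some group homomorphism `φ : F → G`. -/
theorem stmt_3 {F G : Type*} [Group F] [Group G] (n k : ℕ)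
    (abF : F → (Fin n → ℤ)) (abG : G → (Fin k → ℤ))
    (habF : ∀ x y, abF (x * y) = abF x + abF y)
    (habFsurj : Function.Surjective abF)
    (habFker : ∀ x, abF x = 0 ↔ x ∈ commutator F)
    (habG : ∀ x y, abG (x * y) = abG x + abG y)
    (habGsurj : Function.Surjective abG)
    (habGker : ∀ x, abG x = 0 ↔ x ∈ commutator G)
    (f : F) (hf : Finset.univ.gcd (abF f) = 1) :
    ∀ g : G, ∃ φ : F →* G, φ f = g := by
  intro g
  obtain ⟨c, hc⟩ := Finset.univ.gcd_eq_sum_mul (abF f)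
  rw [hf] at hc
  let ψ : F →* Multiplicative ℤ :=
    MonoidHom.mk' (fun x => Multiplicative.ofAdd (∑ i, abF x i * c i)) fun x y => by
      simp [habF, add_mul, Finset.sum_add_distrib]
  refine ⟨(zpowersHom G g).comp ψ, ?_⟩
  change g ^ (∑ i, abF f i * c i) = g
  rw [← hc, zpow_one]
end

section
/- Let k ≥ 2 and 1 ≤ i ≤ k be integers. For a natural number n, let N_i(n) = #{z ∈ {0,1,…,n}^k : gcd(z) = 1, z_1,…,z_i are odd, and z_{i+1},…,z_k are even}, and let N_k(n) = #{z ∈ {0,1,…,n}^k : gcd(z) = 1 and all coordinates z_j are odd}. Then N_i(n) = N_k(n) + o(n^k), i.e. lim_{n→∞} (N_i(n) − N_k(n))/n^k = 0. -/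
open Filter

/-- The elements of `{0,…,n}` divisible by `d` and satisfying `P`. -/
noncomputable def multiplesIn (n d : ℕ) (P : ℤ → Prop) : Finset ℤ := by
  classical exact (Finset.Icc (0 : ℤ) n).filter (fun x => P x ∧ (d : ℤ) ∣ x)

lemma mem_multiplesIn {n d : ℕ} {P : ℤ → Prop} {x : ℤ} :
    x ∈ multiplesIn n d P ↔ (0 ≤ x ∧ x ≤ n) ∧ P x ∧ (d : ℤ) ∣ x := by
  simp [multiplesIn]

lemma card_multiplesIn_le (n d : ℕ) (hd : 0 < d) (P : ℤ → Prop) :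
    (multiplesIn n d P).card ≤ n / d + 1 := by
  classical
  have h : multiplesIn n d P ⊆
      (Finset.range (n / d + 1)).image (fun y : ℕ => (d : ℤ) * y) := by
    intro x hx
    obtain ⟨⟨h0, hn⟩, -, y, rfl⟩ := mem_multiplesIn.1 hx
    have hd' : (0 : ℤ) < d := by exact_mod_cast hd
    have hy : 0 ≤ y := nonneg_of_mul_nonneg_right h0 hd'
    lift y to ℕ using hy
    refine Finset.mem_image.2 ⟨y, ?_, rfl⟩
    rw [Finset.mem_range, Nat.lt_succ_iff, Nat.le_div_iff_mul_le hd, mul_comm]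
    exact_mod_cast hn
  exact (Finset.card_le_card h).trans (Finset.card_image_le.trans (by simp))

lemma card_multiplesIn_odd_le_even (n d : ℕ) (hd : Odd d) :
    (multiplesIn n d Odd).card ≤ (multiplesIn n d Even).card := by
  have hd' : Odd (d : ℤ) := by exact_mod_cast hd
  refine Finset.card_le_card_of_injOn (fun x => x - d) ?_ (by intro x _ y _ h; simpa using h)
  intro x hx
  obtain ⟨⟨h0, hn⟩, ho, hdvd⟩ := mem_multiplesIn.1 hx
  have hpos : 0 < x := lt_of_le_of_ne h0 (by rintro rfl; simp at ho)
  have := Int.le_of_dvd hpos hdvd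
  exact mem_multiplesIn.2 ⟨⟨by grind, by grind⟩, ho.sub_odd hd', hdvd.sub dvd_rfl⟩

lemma card_multiplesIn_even_le_odd_add_one (n d : ℕ) (hd : Odd d) :
    (multiplesIn n d Even).card ≤ (multiplesIn n d Odd).card + 1 := by
  have hd' : Odd (d : ℤ) := by exact_mod_cast hd
  have h : ((multiplesIn n d Even).erase 0).card ≤ (multiplesIn n d Odd).card := by
    refine Finset.card_le_card_of_injOn (fun x => x - d) ?_ (by intro x _ y _ h; simpa using h)
    intro x hx
    obtain ⟨hx0, hx⟩ := Finset.mem_erase.1 hx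
    obtain ⟨⟨h0, hn⟩, he, hdvd⟩ := mem_multiplesIn.1 hx
    have := Int.le_of_dvd (lt_of_le_of_ne h0 hx0.symm) hdvd
    exact mem_multiplesIn.2 ⟨⟨by grind, by grind⟩, he.sub_odd hd', hdvd.sub dvd_rfl⟩
  have := Finset.pred_card_le_card_erase (s := multiplesIn n d Even) (a := 0)
  omega

lemma multiplesIn_odd_eq_empty (n d : ℕ) (hd : ¬ Odd d) : multiplesIn n d Odd = ∅ := by
  refine Finset.eq_empty_of_forall_notMem fun x hx => ?_
  obtain ⟨-, ho, hdvd⟩ := mem_multiplesIn.1 hx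
  have he : Even (d : ℤ) := by exact_mod_cast Nat.not_odd_iff_even.1 hd
  exact Int.not_even_iff_odd.2 ho (even_iff_two_dvd.2 (he.two_dvd.trans hdvd))

/-- If the factors of two products lie in `[0, M]` and differ by at most `1`, the products differ
by at most `#s * M ^ (#s - 1)`. -/
lemma abs_prod_sub_prod_mul_le {ι : Type*} (s : Finset ι) (a b : ι → ℝ) (M : ℝ)
    (ha : ∀ j, 0 ≤ a j) (haM : ∀ j, a j ≤ M) (hb : ∀ j, 0 ≤ b j) (hbM : ∀ j, b j ≤ M)
    (hab : ∀ j, |a j - b j| ≤ 1) (hM : 0 ≤ M) :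
    |∏ j ∈ s, a j - ∏ j ∈ s, b j| * M ≤ s.card * M ^ s.card := by
  classical
  induction s using Finset.induction_on with
  | empty => simp
  | insert x s hx ih =>
    rw [Finset.prod_insert hx, Finset.prod_insert hx, Finset.card_insert_of_notMem hx]
    have hprod : |∏ j ∈ s, b j| ≤ M ^ s.card := by
      rw [abs_of_nonneg (Finset.prod_nonneg fun j _ => hb j)]
      exact (Finset.prod_le_prod (fun j _ => hb j) fun j _ => hbM j).trans_eq (by simp)
    have htri : |a x * ∏ j ∈ s, a j - b x * ∏ j ∈ s, b j| ≤
        M * |∏ j ∈ s, a j - ∏ j ∈ s, b j| + M ^ s.card := by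
      have : a x * ∏ j ∈ s, a j - b x * ∏ j ∈ s, b j =
          a x * (∏ j ∈ s, a j - ∏ j ∈ s, b j) + (a x - b x) * ∏ j ∈ s, b j := by ring
      rw [this]
      refine (abs_add_le _ _).trans ?_
      rw [abs_mul, abs_mul, abs_of_nonneg (ha x)]
      have h1 := mul_le_mul (hab x) hprod (abs_nonneg _) zero_le_one
      have h2 := mul_le_mul_of_nonneg_right (haM x) (abs_nonneg (∏ j ∈ s, a j - ∏ j ∈ s, b j))
      linarith
    have h1 := mul_le_mul_of_nonneg_right htri hM
    have h2 := mul_le_mul_of_nonneg_left ih hM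
    push_cast
    rw [pow_succ]
    nlinarith

/-- Möbius inversion for counting visible vectors in `{0,…,n}^k` with coordinatewise constraints,
one of which excludes `0`. -/
lemma ncard_visible_eq_sum_moebius (k n : ℕ) (P : Fin k → ℤ → Prop) (j₀ : Fin k)
    (hP : ¬ P j₀ 0) :
    ({z : Fin k → ℤ | (∀ j, 0 ≤ z j ∧ z j ≤ (n : ℤ)) ∧ Finset.univ.gcd z = 1 ∧
        ∀ j, P j (z j)}.ncard : ℤ) =
      ∑ d ∈ Finset.Icc 1 n,
        ArithmeticFunction.moebius d * ∏ j, ((multiplesIn n d (P j)).card : ℤ) := by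
  classical
  set B : Finset (Fin k → ℤ) := Fintype.piFinset fun j => multiplesIn n 1 (P j) with hB
  have hmemB (z : Fin k → ℤ) : z ∈ B ↔ ∀ j, (0 ≤ z j ∧ z j ≤ n) ∧ P j (z j) := by
    simp [hB, mem_multiplesIn]
  have hset : {z : Fin k → ℤ | (∀ j, 0 ≤ z j ∧ z j ≤ (n : ℤ)) ∧ Finset.univ.gcd z = 1 ∧
      ∀ j, P j (z j)} = (B.filter fun z => Finset.univ.gcd z = 1 : Finset _) := by
    ext z
    simp only [Set.mem_ofPred_eq, Finset.coe_filter, hmemB, forall_and]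
    tauto
  have hind (z) (hz : z ∈ B) : (if Finset.univ.gcd z = 1 then (1 : ℤ) else 0) =
      ∑ d ∈ Finset.Icc 1 n, if ∀ j, (d : ℤ) ∣ z j then ArithmeticFunction.moebius d else 0 := by
    have hz' := (hmemB z).1 hz
    have hne : z j₀ ≠ 0 := fun h => hP (h ▸ (hz' j₀).2)
    have hpos : 0 < z j₀ := lt_of_le_of_ne (hz' j₀).1.1 hne.symm
    set g := (Finset.univ.gcd z).natAbs with hg
    have hgdvd : ∀ d : ℕ, d ∣ g ↔ ∀ j, (d : ℤ) ∣ z j := by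
      intro d
      rw [hg, ← Int.natCast_dvd, Finset.dvd_gcd_iff]
      simp
    have hg0 : g ≠ 0 := by
      intro h
      have := (hgdvd g).1 dvd_rfl j₀
      rw [h] at this
      simp at this
      exact hne this
    have hgn : g ≤ n := by
      have := Int.le_of_dvd hpos ((hgdvd g).1 dvd_rfl j₀)
      have := (hz' j₀).1.2
      omega
    have hg1 : Finset.univ.gcd z = 1 ↔ g = 1 := by
      constructor
      · intro h; simp [hg, h]
      · intro h
        rw [← Finset.normalize_gcd, ← Int.abs_eq_normalize, Int.abs_eq_natAbs, ← hg, h]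
        rfl
    have hdiv : g.divisors = (Finset.Icc 1 n).filter fun d : ℕ => ∀ j, (d : ℤ) ∣ z j := by
      ext d
      rw [Nat.mem_divisors, Finset.mem_filter, Finset.mem_Icc, ← hgdvd]
      constructor
      · rintro ⟨h, -⟩
        exact ⟨⟨Nat.pos_of_dvd_of_pos h (Nat.pos_of_ne_zero hg0),
          (Nat.le_of_dvd (Nat.pos_of_ne_zero hg0) h).trans hgn⟩, h⟩
      · rintro ⟨-, h⟩
        exact ⟨h, hg0⟩
    rw [← Finset.sum_filter, ← hdiv, ← ArithmeticFunction.coe_mul_zeta_apply,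
      ArithmeticFunction.moebius_mul_coe_zeta, ArithmeticFunction.one_apply]
    simp only [hg1]
  rw [hset, Set.ncard_coe_finset, Finset.card_filter]
  push_cast
  rw [Finset.sum_congr rfl hind, Finset.sum_comm]
  refine Finset.sum_congr rfl fun d _ => ?_
  rw [← Finset.sum_filter, Finset.sum_const, nsmul_eq_mul, mul_comm]
  congr 1
  rw [← Nat.cast_prod, ← Fintype.card_piFinset]
  congr 2
  ext z
  simp only [Finset.mem_filter, hmemB, Fintype.mem_piFinset, mem_multiplesIn, ← forall_and]
  exact forall_congr' fun j => by tauto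

lemma tendsto_harmonic_div_atTop :
    Tendsto (fun n : ℕ => (n : ℝ)⁻¹ * ∑ d ∈ Finset.Icc 1 n, (d : ℝ)⁻¹) atTop (nhds 0) := by
  have h := (tendsto_inv_atTop_zero.comp
    ((tendsto_natCast_atTop_atTop (R := ℝ)).comp (tendsto_add_atTop_nat 1))).cesaro
  refine h.congr fun n => ?_
  have h0 := Finset.sum_Ico_add' (fun d : ℕ => (d : ℝ)⁻¹) 0 n 1
  rw [zero_add] at h0
  rw [Finset.range_eq_Ico, ← Finset.Ico_add_one_right_eq_Icc, ← h0]
  simp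

/-- Let `k ≥ 2` and `1 ≤ i ≤ k`. Let `N_i(n)` count the visible vectors `z ∈ {0,…,n}^k`
whose first `i` coordinates are odd and whose remaining coordinates are even, and let
`N_k(n)` count the visible vectors in `{0,…,n}^k` with all coordinates odd. Then
`N_i(n) = N_k(n) + o(n^k)`. -/
theorem stmt_7 (k i : ℕ) (hk : 2 ≤ k) (hi1 : 1 ≤ i) (hik : i ≤ k) :
    Tendsto (fun n : ℕ =>
      ((({z : Fin k → ℤ | (∀ j, 0 ≤ z j ∧ z j ≤ (n : ℤ)) ∧ Finset.univ.gcd z = 1 ∧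
            ∀ j : Fin k, if (j : ℕ) < i then Odd (z j) else Even (z j)}.ncard : ℝ) -
          ({z : Fin k → ℤ | (∀ j, 0 ≤ z j ∧ z j ≤ (n : ℤ)) ∧ Finset.univ.gcd z = 1 ∧
            ∀ j : Fin k, Odd (z j)}.ncard : ℝ)) / (n : ℝ) ^ k))
      atTop (nhds 0) := by
  set P : Fin k → ℤ → Prop := fun j x => if (j : ℕ) < i then Odd x else Even x with hPdef
  let j₀ : Fin k := ⟨0, by omega⟩
  have hP₀ : P j₀ = Odd := by
    funext x
    simp only [hPdef, j₀, if_pos (show 0 < i by omega)]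
  have hN₁ (n : ℕ) := congrArg (Int.cast : ℤ → ℝ)
    (ncard_visible_eq_sum_moebius k n P j₀ (by rw [hP₀]; simp))
  have hN₂ (n : ℕ) := congrArg (Int.cast : ℤ → ℝ)
    (ncard_visible_eq_sum_moebius k n (fun _ => Odd) j₀ (by simp))
  push_cast at hN₁ hN₂
  have hlim := tendsto_harmonic_div_atTop.const_mul ((k : ℝ) * 2 ^ k)
  rw [mul_zero] at hlim
  refine squeeze_zero_norm (fun n => ?_) hlim
  rw [hN₁, hN₂, ← Finset.sum_sub_distrib, Finset.sum_div, Finset.mul_sum, Finset.mul_sum]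
  refine norm_sum_le_of_le _ fun d hd => ?_
  obtain ⟨hd1, hdn⟩ := Finset.mem_Icc.1 hd
  have hd1' : (1 : ℝ) ≤ d := by exact_mod_cast hd1
  have hdn' : (d : ℝ) ≤ n := by exact_mod_cast hdn
  have hd0 : (0 : ℝ) < d := by linarith
  have hn0 : (0 : ℝ) < n := by linarith
  rw [← mul_sub, Real.norm_eq_abs, abs_div, abs_mul, abs_of_nonneg (pow_nonneg hn0.le k)]
  by_cases hodd : Odd d
  swap
  · rw [Finset.prod_eq_zero (Finset.mem_univ j₀) (by rw [hP₀, multiplesIn_odd_eq_empty n d hodd]; simp),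
      Finset.prod_eq_zero (Finset.mem_univ j₀) (by rw [multiplesIn_odd_eq_empty n d hodd]; simp)]
    simp only [sub_self, abs_zero, mul_zero, zero_div]
    positivity
  have hcard (Q : ℤ → Prop) : ((multiplesIn n d Q).card : ℝ) ≤ 2 * n / d := by
    have h1 : ((multiplesIn n d Q).card : ℝ) ≤ ((n / d : ℕ) : ℝ) + 1 := by
      exact_mod_cast card_multiplesIn_le n d hd1 Q
    have h2 : ((n / d : ℕ) : ℝ) ≤ n / d := Nat.cast_div_le
    have h3 : (1 : ℝ) ≤ n / d := (one_le_div hd0).2 hdn'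
    calc _ ≤ (n : ℝ) / d + n / d := by linarith
      _ = _ := by ring
  have hdiff (j : Fin k) :
      |((multiplesIn n d (P j)).card : ℝ) - (multiplesIn n d Odd).card| ≤ 1 := by
    by_cases hj : (j : ℕ) < i
    · have : P j = Odd := by funext x; simp only [hPdef, if_pos hj]
      simp [this]
    · have : P j = Even := by funext x; simp only [hPdef, if_neg hj]
      rw [this]
      have h1 : ((multiplesIn n d Odd).card : ℝ) ≤ (multiplesIn n d Even).card := by
        exact_mod_cast card_multiplesIn_odd_le_even n d hodd
      have h2 : ((multiplesIn n d Even).card : ℝ) ≤ (multiplesIn n d Odd).card + 1 := by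
        exact_mod_cast card_multiplesIn_even_le_odd_add_one n d hodd
      rw [abs_le]
      constructor <;> linarith
  have hmain := abs_prod_sub_prod_mul_le Finset.univ
    (fun j => ((multiplesIn n d (P j)).card : ℝ)) (fun _ => ((multiplesIn n d Odd).card : ℝ))
    (2 * n / d) (fun _ => by positivity) (fun _ => hcard _) (fun _ => by positivity)
    (fun _ => hcard _) hdiff (by positivity)
  rw [Finset.card_univ, Fintype.card_fin] at hmain
  set Δ := |∏ j, ((multiplesIn n d (P j)).card : ℝ) - ∏ _j : Fin k, ((multiplesIn n d Odd).card : ℝ)|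
  have hΔ : 0 ≤ Δ := abs_nonneg _
  have hmu : |((ArithmeticFunction.moebius d : ℤ) : ℝ)| ≤ 1 := by
    exact_mod_cast ArithmeticFunction.abs_moebius_le_one
  have hpow : (d : ℝ) ^ 2 ≤ (d : ℝ) ^ k := pow_le_pow_right₀ hd1' hk
  rw [div_le_iff₀ (pow_pos hn0 k)]
  calc _ ≤ Δ := mul_le_of_le_one_left hΔ hmu
    _ ≤ k * (2 * n / d) ^ k / (2 * n / d) := (le_div_iff₀ (by positivity)).2 hmain
    _ = (k * 2 ^ k * n ^ k / n) * (d / 2 / d ^ k) := by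
      rw [div_pow, mul_pow]; field_simp
    _ ≤ (k * 2 ^ k * n ^ k / n) * (d : ℝ)⁻¹ := by
      gcongr
      rw [div_le_iff₀ (by positivity), inv_mul_eq_div, le_div_iff₀ hd0]
      nlinarith
    _ = _ := by field_simp
end

section
/- Let r ≥ 2 and let G_r ≤ SL(r,ℤ) be the subgroup of matrices congruent to the identity modulo 2. Let S ⊆ ℤ^r be invariant under the natural action of G_r and suppose the strict asymptotic density δ = lim_{n→∞} #{z ∈ S : ‖z‖_∞ ≤ n}/#{z ∈ ℤ^r : ‖z‖_∞ ≤ n} exists. Let Ω ⊆ ℝ^r be a bounded open set whose boundary has Lebesgue measure zero. Then lim_{t→∞} #(S ∩ tΩ)/t^r = δ·λ(Ω), where the limit is over real t → ∞, tΩ = {tx : x ∈ Ω}, and λ is Lebesgue measure on ℝ^r. -/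
open Filter Pointwise

/-- The vector in `ℝ^r` with the same coordinates as a given integer vector. -/
def realVec {r : ℕ} (z : Fin r → ℤ) : Fin r → ℝ := fun i => z i

/-- The weighted number of lattice points in `t • Ω`. -/
noncomputable def weightedCount {r : ℕ} (w : (Fin r → ℤ) → ℝ) (Ω : Set (Fin r → ℝ)) (t : ℝ) : ℝ :=
  ∑' z, w z * Ω.indicator 1 (t⁻¹ • realVec z)

/-- The weight `w` equidistributes with density `κ`. -/
def HasDensity {r : ℕ} (w : (Fin r → ℤ) → ℝ) (κ : ℝ) : Prop :=
  ∀ Ω : Set (Fin r → ℝ), Bornology.IsBounded Ω → MeasurableSet Ω →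
    MeasureTheory.volume (frontier Ω) = 0 →
    Tendsto (fun t : ℝ => weightedCount w Ω t / t ^ r) atTop
      (nhds (κ * (MeasureTheory.volume Ω).toReal))

/-- The nonnegative gcd of the coordinates of an integer vector. -/
def content {r : ℕ} (z : Fin r → ℤ) : ℕ := Finset.univ.gcd fun i => (z i).natAbs

theorem dvd_content_iff {r : ℕ} {z : Fin r → ℤ} {d : ℕ} :
    d ∣ content z ↔ ∀ i, (d : ℤ) ∣ z i := by
  simp [content, Finset.dvd_gcd_iff, Int.natCast_dvd]

theorem content_eq_zero_iff {r : ℕ} {z : Fin r → ℤ} : content z = 0 ↔ z = 0 := by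
  simp [content, Finset.gcd_eq_zero_iff, funext_iff]

theorem content_smul {r : ℕ} (d : ℕ) (z : Fin r → ℤ) :
    content (fun i => (d : ℤ) * z i) = d * content z := by
  simp [content, Int.natAbs_mul, Finset.gcd_mul_left]

theorem mem_Icc_floor_of_mem {r : ℕ} {Ω : Set (Fin r → ℝ)} {R t : ℝ}
    (hR : ∀ x ∈ Ω, ‖x‖ ≤ R) (ht : 0 < t) {z : Fin r → ℤ} (hz : t⁻¹ • realVec z ∈ Ω) :
    z ∈ Fintype.piFinset fun _ : Fin r => Finset.Icc (-⌊t * R⌋) ⌊t * R⌋ := by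
  rw [Fintype.mem_piFinset]
  intro i
  have h1 := (norm_le_pi_norm _ i).trans (hR _ hz)
  simp only [Pi.smul_apply, smul_eq_mul, Real.norm_eq_abs, realVec, abs_mul, abs_inv,
    abs_of_pos ht] at h1
  have h2 : |(z i : ℝ)| ≤ t * R := by
    rwa [inv_mul_le_iff₀ ht] at h1
  have h3 : |z i| ≤ ⌊t * R⌋ := by
    rw [Int.le_floor]; exact_mod_cast h2
  rw [Finset.mem_Icc]
  exact abs_le.mp h3

theorem finite_setOf_mem {r : ℕ} {Ω : Set (Fin r → ℝ)} (hΩ : Bornology.IsBounded Ω)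
    {t : ℝ} (ht : 0 < t) : {z : Fin r → ℤ | t⁻¹ • realVec z ∈ Ω}.Finite := by
  obtain ⟨R, hR⟩ := hΩ.exists_norm_le
  exact (Finset.finite_toSet _).subset fun z hz => mem_Icc_floor_of_mem hR ht hz

theorem summable_weightedCount {r : ℕ} {Ω : Set (Fin r → ℝ)} (hΩ : Bornology.IsBounded Ω)
    {t : ℝ} (ht : 0 < t) (w : (Fin r → ℤ) → ℝ) :
    Summable fun z => w z * Ω.indicator 1 (t⁻¹ • realVec z) := by
  refine summable_of_hasFiniteSupport ((finite_setOf_mem hΩ ht).subset fun z hz => ?_)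
  by_contra h
  exact hz (by simp only [Set.mem_ofPred_eq] at h; simp [h])

theorem abs_weightedCount_le {r : ℕ} {Ω : Set (Fin r → ℝ)} (hΩ : Bornology.IsBounded Ω) :
    ∃ C : ℝ, ∀ w : (Fin r → ℤ) → ℝ, w 0 = 0 → (∀ z, |w z| ≤ 1) →
      ∀ t : ℝ, 0 < t → |weightedCount w Ω t| ≤ C * t ^ r := by
  obtain ⟨R, hR0, hR⟩ := hΩ.exists_pos_norm_le
  refine ⟨(3 * R) ^ r, fun w hw0 hw t ht => ?_⟩
  set m := ⌊t * R⌋ with hm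
  have hm0 : 0 ≤ m := Int.floor_nonneg.mpr (by positivity)
  have hmle : (m : ℝ) ≤ t * R := Int.floor_le _
  have hsum : weightedCount w Ω t = ∑ z ∈ Fintype.piFinset fun _ : Fin r => Finset.Icc (-m) m,
      w z * Ω.indicator 1 (t⁻¹ • realVec z) := by
    refine tsum_eq_sum fun z hz => ?_
    have : t⁻¹ • realVec z ∉ Ω := fun h => hz (mem_Icc_floor_of_mem hR ht h)
    simp [this]
  rw [hsum]
  rcases hm0.eq_or_lt with h | h
  · rw [← h]
    rw [Finset.sum_eq_zero]
    · simp; positivity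
    · intro z hz
      have : z = 0 := by
        funext i
        have := Fintype.mem_piFinset.mp hz i
        simpa using this
      simp [this, hw0]
  · refine (Finset.abs_sum_le_sum_abs _ _).trans ?_
    have hle : ∀ z ∈ Fintype.piFinset fun _ : Fin r => Finset.Icc (-m) m,
        |w z * Ω.indicator 1 (t⁻¹ • realVec z)| ≤ 1 := by
      intro z _
      rw [abs_mul]
      refine mul_le_one₀ (hw z) (abs_nonneg _) ?_
      by_cases hz : t⁻¹ • realVec z ∈ Ω <;> simp [hz]
    refine (Finset.sum_le_card_nsmul _ _ 1 hle).trans ?_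
    simp only [Fintype.card_piFinset, Int.card_Icc, Finset.prod_const, Finset.card_univ,
      Fintype.card_fin, nsmul_eq_mul, mul_one, Nat.cast_pow]
    rw [← mul_pow]
    refine pow_le_pow_left₀ (by positivity) ?_ r
    have h1 : (((m + 1 - -m).toNat : ℤ) : ℝ) = 2 * m + 1 := by
      rw [Int.toNat_of_nonneg (by omega)]; push_cast; ring
    have h2 : (1 : ℝ) ≤ m := by exact_mod_cast h
    rw [Int.cast_natCast] at h1
    rw [h1]; nlinarith

theorem HasDensity.congr {r : ℕ} {w v : (Fin r → ℤ) → ℝ} {κ : ℝ} (h : HasDensity w κ)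
    (hwv : ∀ z, v z = w z) : HasDensity v κ := by
  rwa [show v = w from funext hwv]

theorem HasDensity.const_mul {r : ℕ} {w : (Fin r → ℤ) → ℝ} {κ : ℝ} (h : HasDensity w κ) (a : ℝ) :
    HasDensity (fun z => a * w z) (a * κ) := by
  intro Ω h1 h2 h3
  have := (h Ω h1 h2 h3).const_mul a
  simp only [weightedCount, mul_assoc, tsum_mul_left, mul_div_assoc] at this ⊢
  exact this

theorem HasDensity.add {r : ℕ} {w v : (Fin r → ℤ) → ℝ} {κ μ : ℝ} (hw : HasDensity w κ)
    (hv : HasDensity v μ) : HasDensity (fun z => w z + v z) (κ + μ) := by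
  intro Ω h1 h2 h3
  have := (hw Ω h1 h2 h3).add (hv Ω h1 h2 h3)
  rw [← add_mul] at this
  refine this.congr' ?_
  filter_upwards [eventually_gt_atTop 0] with t ht
  rw [← add_div]
  congr 1
  simp only [weightedCount, add_mul]
  rw [(summable_weightedCount h1 ht w).tsum_add (summable_weightedCount h1 ht v)]

theorem HasDensity.sum {r : ℕ} {ι : Type*} (s : Finset ι) {w : ι → (Fin r → ℤ) → ℝ} {κ : ι → ℝ}
    (h : ∀ c ∈ s, HasDensity (w c) (κ c)) :
    HasDensity (fun z => ∑ c ∈ s, w c z) (∑ c ∈ s, κ c) := by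
  intro Ω h1 h2 h3
  have := tendsto_finsetSum s fun c hc => h c hc Ω h1 h2 h3
  rw [← Finset.sum_mul] at this
  refine this.congr' ?_
  filter_upwards [eventually_gt_atTop 0] with t ht
  rw [← Finset.sum_div]
  congr 1
  simp only [weightedCount, Finset.sum_mul]
  rw [Summable.tsum_finsetSum fun c _ => summable_weightedCount h1 ht (w c)]

theorem weightedCount_sum_divisors {r : ℕ} {w : ℕ → (Fin r → ℤ) → ℝ} (h0 : ∀ d, w d 0 = 0)
    {Ω : Set (Fin r → ℝ)} (hΩ : Bornology.IsBounded Ω) {t : ℝ} (ht : 0 < t) :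
    weightedCount (fun z => ∑ d ∈ (content z).divisors, w d fun i => z i / d) Ω t =
      ∑' d : ℕ, if d = 0 then 0 else weightedCount (w d) Ω (t / d) := by
  classical
  set f : (Fin r → ℤ) → ℕ → ℝ := fun z d =>
    if d ∈ (content z).divisors then
      w d (fun i => z i / d) * Ω.indicator 1 (t⁻¹ • realVec z) else 0 with hf
  have h1 : weightedCount (fun z => ∑ d ∈ (content z).divisors, w d fun i => z i / d) Ω t =
      ∑' z, ∑' d, f z d := by
    refine tsum_congr fun z => ?_
    rw [tsum_eq_sum (s := (content z).divisors) (fun d hd => by simp only [hf, if_neg hd]),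
      Finset.sum_mul]
    exact Finset.sum_congr rfl fun d hd => by simp only [hf, if_pos hd]
  have hsupp : Summable (Function.uncurry f) := by
    refine summable_of_hasFiniteSupport (Set.Finite.subset
      (((finite_setOf_mem hΩ ht).toFinset.biUnion
        fun z => {z} ×ˢ (content z).divisors).finite_toSet) ?_)
    rintro ⟨z, d⟩ hzd
    simp only [Function.mem_support, Function.uncurry_apply_pair, hf] at hzd
    have hd : d ∈ (content z).divisors := by
      by_contra h; exact hzd (if_neg h)
    have hz : t⁻¹ • realVec z ∈ Ω := by
      by_contra h; exact hzd (by simp [h])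
    simp only [Finset.mem_coe, Finset.mem_biUnion, Set.Finite.mem_toFinset, Set.mem_ofPred_eq,
      Finset.mem_product, Finset.mem_singleton]
    exact ⟨z, hz, rfl, hd⟩
  rw [h1, ← hsupp.tsum_comm]
  refine tsum_congr fun d => ?_
  split_ifs with hd
  · simp [hf, hd]
  have hdz : (d : ℤ) ≠ 0 := by exact_mod_cast hd
  have hinj : Function.Injective fun (y : Fin r → ℤ) (i : Fin r) => (d : ℤ) * y i := by
    intro x y hxy
    funext i
    exact mul_left_cancel₀ hdz (congrFun hxy i)
  rw [← hinj.tsum_eq]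
  · refine tsum_congr fun y => ?_
    have hs : t⁻¹ • realVec (fun i => (d : ℤ) * y i) = (t / d)⁻¹ • realVec y := by
      funext i
      simp [realVec]; ring
    by_cases hy : y = 0
    · subst hy
      have hc : content (fun i : Fin r => (d : ℤ) * (0 : Fin r → ℤ) i) = 0 :=
        content_eq_zero_iff.mpr (by funext i; simp)
      simp only [hf, hc, Nat.divisors_zero, Finset.notMem_empty, if_false, h0, zero_mul]
    · have hm : d ∈ (content fun i => (d : ℤ) * y i).divisors := by
        rw [content_smul, Nat.mem_divisors]
        exact ⟨dvd_mul_right _ _, mul_ne_zero hd (content_eq_zero_iff.not.mpr hy)⟩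
      simp only [hf, if_pos hm, hs]
      congr 2
      funext i
      exact Int.mul_ediv_cancel_left _ hdz
  · intro z hz
    have hm : d ∈ (content z).divisors := by
      by_contra h; exact hz (by simp only [hf, if_neg h])
    refine ⟨fun i => z i / d, funext fun i => ?_⟩
    exact Int.mul_ediv_cancel' (dvd_content_iff.mp (Nat.dvd_of_mem_divisors hm) i)

theorem HasDensity.sum_divisors {r : ℕ} (hr : 2 ≤ r) {w : ℕ → (Fin r → ℤ) → ℝ} {κ : ℕ → ℝ}
    (h : ∀ d, HasDensity (w d) (κ d)) (h0 : ∀ d, w d 0 = 0) (hb : ∀ d z, |w d z| ≤ 1) :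
    HasDensity (fun z => ∑ d ∈ (content z).divisors, w d fun i => z i / d)
      (∑' d : ℕ, κ d / (d : ℝ) ^ r) := by
  intro Ω h1 h2 h3
  obtain ⟨C, hC⟩ := abs_weightedCount_le h1
  have hr0 : r ≠ 0 := by omega
  rw [← tsum_mul_right]
  have key : Tendsto (fun t : ℝ => ∑' d : ℕ,
      (if d = 0 then 0 else weightedCount (w d) Ω (t / d)) / t ^ r) atTop
      (nhds (∑' d : ℕ, κ d / (d : ℝ) ^ r * (MeasureTheory.volume Ω).toReal)) := by
    refine tendsto_tsum_of_dominated_convergence (bound := fun d : ℕ => C * (1 / (d : ℝ) ^ r))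
      ((Real.summable_one_div_nat_pow.mpr (by omega)).mul_left C) (fun d => ?_) ?_
    · by_cases hd : d = 0
      · simp [hd, hr0]
      · have hd' : (0 : ℝ) < d := by exact_mod_cast Nat.pos_of_ne_zero hd
        have := ((h d Ω h1 h2 h3).comp
          (tendsto_id.atTop_div_const hd')).div_const ((d : ℝ) ^ r)
        simp only [if_neg hd]
        convert this using 2
        · simp only [Function.comp, id, div_pow]
          field_simp
        · ring
    · filter_upwards [eventually_gt_atTop 0] with t ht d
      by_cases hd : d = 0
      · simp [hd, hr0]
      · have hd' : (0 : ℝ) < d := by exact_mod_cast Nat.pos_of_ne_zero hd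
        simp only [if_neg hd]
        rw [Real.norm_eq_abs, abs_div, abs_of_pos (pow_pos ht r), div_le_iff₀ (pow_pos ht r)]
        refine (hC (w d) (h0 d) (hb d) (t / d) (by positivity)).trans (le_of_eq ?_)
        rw [div_pow]; ring
  refine key.congr' ?_
  filter_upwards [eventually_gt_atTop 0] with t ht
  rw [weightedCount_sum_divisors h0 h1 ht, tsum_div_const]

open MeasureTheory in
theorem lintegral_indicator_floor {r : ℕ} (a : Fin r → ℝ) {Ω : Set (Fin r → ℝ)} {h : ℝ}
    (hh : 0 < h) :
    ∫⁻ x : Fin r → ℝ, Ω.indicator 1 (h • (realVec (fun i => ⌊x i / h⌋) + a)) =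
      ∑' y : Fin r → ℤ, Ω.indicator 1 (h • (realVec y + a)) * ENNReal.ofReal h ^ r := by
  set φ : (Fin r → ℝ) → (Fin r → ℤ) := fun x i => ⌊x i / h⌋ with hφ
  have hφm : Measurable φ := by fun_prop
  have h1 := lintegral_map (μ := volume)
    (f := fun y : Fin r → ℤ => Ω.indicator (1 : (Fin r → ℝ) → ENNReal) (h • (realVec y + a)))
    (measurable_of_countable _) hφm
  rw [← h1, lintegral_countable']
  refine tsum_congr fun y => ?_
  congr 1
  rw [Measure.map_apply hφm (measurableSet_singleton y)]
  have h2 : φ ⁻¹' {y} =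
      Set.univ.pi fun i => Set.Ico (h * (y i : ℝ)) (h * ((y i : ℝ) + 1)) := by
    ext x
    simp only [hφ, Set.mem_preimage, Set.mem_singleton_iff, funext_iff, Int.floor_eq_iff,
      Set.mem_univ_pi, Set.mem_Ico, le_div_iff₀' hh, div_lt_iff₀' hh]
  rw [h2, Real.volume_pi_Ico]
  simp only [mul_add, mul_one, add_sub_cancel_left, Finset.prod_const, Finset.card_univ,
    Fintype.card_fin]

theorem abs_floor_approx_le {h x a : ℝ} (hh : 0 < h) :
    |h * ((⌊x / h⌋ : ℝ) + a) - x| ≤ h * (1 + |a|) := by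
  have h1 := Int.floor_le (x / h)
  have h2 := (Int.lt_floor_add_one (x / h)).le
  rw [le_div_iff₀' hh] at h1
  rw [div_le_iff₀' hh] at h2
  have h3 := mul_le_mul_of_nonneg_left (le_abs_self a) hh.le
  have h4 := mul_le_mul_of_nonneg_left (neg_abs_le a) hh.le
  rw [abs_le]
  constructor <;> nlinarith

theorem norm_floor_approx_le {r : ℕ} {h : ℝ} (hh : 0 < h) (x a : Fin r → ℝ) :
    ‖h • (realVec (fun i => ⌊x i / h⌋) + a) - x‖ ≤ h * (1 + ‖a‖) := by
  refine (pi_norm_le_iff_of_nonneg (by positivity)).mpr fun i => ?_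
  have := norm_le_pi_norm a i
  rw [Real.norm_eq_abs] at this
  calc _ ≤ h * (1 + |a i|) := abs_floor_approx_le hh
    _ ≤ _ := by gcongr

open MeasureTheory in
theorem tendsto_tsum_indicator_shifted_lattice {r : ℕ} (a : Fin r → ℝ) {Ω : Set (Fin r → ℝ)}
    (hb : Bornology.IsBounded Ω) (hm : MeasurableSet Ω) (hf : volume (frontier Ω) = 0) :
    Tendsto (fun h : ℝ => (∑' y : Fin r → ℤ, Ω.indicator (1 : (Fin r → ℝ) → ℝ) (h • (realVec y + a))) * h ^ r)
      (nhdsWithin 0 (Set.Ioi 0)) (nhds (volume Ω).toReal) := by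
  obtain ⟨R, hR⟩ := hb.exists_norm_le
  have hlim : Tendsto (fun h : ℝ =>
      ∫⁻ x : Fin r → ℝ, Ω.indicator 1 (h • (realVec (fun i => ⌊x i / h⌋) + a)))
      (nhdsWithin 0 (Set.Ioi 0)) (nhds (∫⁻ x, Ω.indicator 1 x)) := by
    refine tendsto_lintegral_filter_of_dominated_convergence
      ((Metric.closedBall 0 (R + (1 + ‖a‖))).indicator 1) ?_ ?_ ?_ ?_
    · refine Eventually.of_forall fun h => ?_
      refine (measurable_of_countable
        (fun y : Fin r → ℤ => Ω.indicator (1 : (Fin r → ℝ) → ENNReal) (h • (realVec y + a)))).comp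
        (f := fun x : Fin r → ℝ => fun i => ⌊x i / h⌋) ?_
      fun_prop
    · filter_upwards [Ioc_mem_nhdsGT (zero_lt_one' ℝ)] with h hh
      refine Eventually.of_forall fun x => ?_
      by_cases hx : h • (realVec (fun i => ⌊x i / h⌋) + a) ∈ Ω
      · have h1 := norm_floor_approx_le hh.1 x a
        have h2 : h * (1 + ‖a‖) ≤ 1 + ‖a‖ := mul_le_of_le_one_left (by positivity) hh.2
        have h3 : x ∈ Metric.closedBall (0 : Fin r → ℝ) (R + (1 + ‖a‖)) := by
          rw [mem_closedBall_zero_iff]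
          have h4 := norm_sub_norm_le x (h • (realVec (fun i => ⌊x i / h⌋) + a))
          rw [norm_sub_rev] at h4
          linarith [hR _ hx]
        simp [-smul_add, hx, h3]
      · simp [-smul_add, hx]
    · rw [lintegral_indicator_one Metric.isClosed_closedBall.measurableSet]
      exact measure_closedBall_lt_top.ne
    · have hae : ∀ᵐ x, x ∉ frontier Ω := measure_eq_zero_iff_ae_notMem.mp hf
      filter_upwards [hae] with x hx
      have hto : Tendsto (fun h : ℝ => h • (realVec (fun i => ⌊x i / h⌋) + a))
          (nhdsWithin 0 (Set.Ioi 0)) (nhds x) := by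
        rw [tendsto_iff_norm_sub_tendsto_zero]
        have h0 : Tendsto (fun h : ℝ => h * (1 + ‖a‖)) (nhdsWithin 0 (Set.Ioi 0)) (nhds 0) := by
          have : Continuous fun h : ℝ => h * (1 + ‖a‖) := by fun_prop
          simpa using (this.tendsto 0).mono_left nhdsWithin_le_nhds
        refine squeeze_zero' (Eventually.of_forall fun _ => norm_nonneg _) ?_ h0
        filter_upwards [self_mem_nhdsWithin] with h hh
        exact norm_floor_approx_le hh x a
      refine tendsto_const_nhds.congr' ?_
      by_cases hxΩ : x ∈ Ω
      · have : x ∈ interior Ω := by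
          by_contra h; exact hx ⟨subset_closure hxΩ, h⟩
        filter_upwards [hto.eventually (isOpen_interior.mem_nhds this)] with h hh
        have hmem : h • (realVec (fun i => ⌊x i / h⌋) + a) ∈ Ω := interior_subset hh
        simp [-smul_add, hxΩ, hmem]
      · have : x ∈ (closure Ω)ᶜ := fun h => hx ⟨h, fun h' => hxΩ (interior_subset h')⟩
        filter_upwards [hto.eventually (isClosed_closure.isOpen_compl.mem_nhds this)] with h hh
        have hmem : h • (realVec (fun i => ⌊x i / h⌋) + a) ∉ Ω := fun h' => hh (subset_closure h')
        simp [-smul_add, hxΩ, hmem]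
  rw [lintegral_indicator_one hm] at hlim
  have hfin : volume Ω ≠ ⊤ := hb.measure_lt_top.ne
  refine ((ENNReal.tendsto_toReal hfin).comp hlim).congr' ?_
  filter_upwards [self_mem_nhdsWithin] with h hh
  have hh' : (0 : ℝ) < h := hh
  simp only [Function.comp]
  rw [lintegral_indicator_floor a hh', ENNReal.tsum_mul_right, ENNReal.toReal_mul,
    ENNReal.toReal_pow, ENNReal.toReal_ofReal hh'.le, ENNReal.tsum_toReal_eq]
  · congr 1
    refine tsum_congr fun y => ?_
    by_cases hy : h • (realVec y + a) ∈ Ω <;> simp [-smul_add, hy]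
  · intro y
    by_cases hy : h • (realVec y + a) ∈ Ω <;> simp [-smul_add, hy]

theorem hasDensity_emod_two {r : ℕ} (c : Fin r → ℤ) (hc : ∀ i, c i % 2 = c i) :
    HasDensity (fun z => if (fun i => z i % 2) = c then 1 else 0) ((2 ^ r)⁻¹) := by
  intro Ω h1 h2 h3
  have hto : Tendsto (fun t : ℝ => 2 * t⁻¹) atTop (nhdsWithin 0 (Set.Ioi 0)) := by
    refine tendsto_nhdsWithin_iff.mpr ⟨?_, ?_⟩
    · simpa using (tendsto_inv_atTop_zero (𝕜 := ℝ)).const_mul 2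
    · filter_upwards [eventually_gt_atTop 0] with t ht
      exact Set.mem_Ioi.mpr (by positivity)
  have key := ((tendsto_tsum_indicator_shifted_lattice (fun i => (c i : ℝ) / 2) h1 h2 h3).comp
    hto).const_mul ((2 ^ r : ℝ)⁻¹)
  refine key.congr fun t => ?_
  have hinj : Function.Injective fun (y : Fin r → ℤ) (i : Fin r) => 2 * y i + c i := by
    intro x y hxy
    funext i
    have := congrFun hxy i
    simp only at this
    omega
  simp only [Function.comp, weightedCount]
  rw [← hinj.tsum_eq (f := fun z => (if (fun i => z i % 2) = c then (1 : ℝ) else 0) *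
    Ω.indicator 1 (t⁻¹ • realVec z)), mul_pow, inv_pow, div_eq_mul_inv, mul_left_comm,
    inv_mul_cancel_left₀ (by positivity)]
  · congr 1
    refine tsum_congr fun y => ?_
    have hpar : (fun i => (2 * y i + c i) % 2) = c := by
      funext i
      have := hc i
      omega
    rw [if_pos hpar, one_mul]
    congr 1
    funext i
    simp [realVec]; ring
  · intro z hz
    have hzc : (fun i => z i % 2) = c := by
      by_contra h; exact hz (by simp [h])
    refine ⟨fun i => z i / 2, funext fun i => ?_⟩
    have := congrFun hzc i
    simp only at this ⊢
    omega

/-- The principal congruence subgroup of level two. -/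
abbrev levelTwo (r : ℕ) : Subgroup (Matrix.SpecialLinearGroup (Fin r) ℤ) :=
  (Matrix.SpecialLinearGroup.map (Int.castRingHom (ZMod 2))).ker

theorem mem_levelTwo_iff {r : ℕ} {M : Matrix.SpecialLinearGroup (Fin r) ℤ} :
    M ∈ levelTwo r ↔ (M : Matrix (Fin r) (Fin r) ℤ).map (Int.cast : ℤ → ZMod 2) = 1 := by
  rw [MonoidHom.mem_ker, Matrix.SpecialLinearGroup.ext_iff, ← Matrix.ext_iff]
  rfl

theorem mulVec_emod_two {r : ℕ} {M : Matrix.SpecialLinearGroup (Fin r) ℤ} (hM : M ∈ levelTwo r)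
    (z : Fin r → ℤ) (i : Fin r) :
    (M : Matrix (Fin r) (Fin r) ℤ).mulVec z i % 2 = z i % 2 := by
  have h := RingHom.map_mulVec (Int.castRingHom (ZMod 2)) (M : Matrix (Fin r) (Fin r) ℤ) z i
  have h' : (M : Matrix (Fin r) (Fin r) ℤ).map (Int.castRingHom (ZMod 2)) = 1 :=
    mem_levelTwo_iff.mp hM
  rw [h', Matrix.one_mulVec] at h
  exact (ZMod.intCast_eq_intCast_iff' _ _ 2).mp h

theorem dvd_content_of_dvd_content_mulVec {r : ℕ} (M : Matrix.SpecialLinearGroup (Fin r) ℤ)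
    {z : Fin r → ℤ} {d : ℕ} (h : d ∣ content ((M : Matrix (Fin r) (Fin r) ℤ).mulVec z)) :
    d ∣ content z := by
  rw [dvd_content_iff] at h ⊢
  have hz : z = ((M⁻¹ : Matrix.SpecialLinearGroup (Fin r) ℤ) : Matrix (Fin r) (Fin r) ℤ).mulVec
      ((M : Matrix (Fin r) (Fin r) ℤ).mulVec z) := by
    rw [Matrix.mulVec_mulVec, ← Matrix.SpecialLinearGroup.coe_mul, inv_mul_cancel,
      Matrix.SpecialLinearGroup.coe_one, Matrix.one_mulVec]
  intro i
  rw [hz]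
  simp only [Matrix.mulVec, dotProduct] at h ⊢
  exact Finset.dvd_sum fun j _ => Dvd.dvd.mul_left (h j) _

theorem exists_levelTwo_transvection {r : ℕ} {i j : Fin r} (hij : i ≠ j) (c : ℤ) :
    ∃ M ∈ levelTwo r, ∀ z : Fin r → ℤ,
      (M : Matrix (Fin r) (Fin r) ℤ).mulVec z = Function.update z i (z i + 2 * c * z j) := by
  refine ⟨⟨Matrix.transvection i j (2 * c), Matrix.det_transvection_of_ne i j hij _⟩, ?_, ?_⟩
  · refine mem_levelTwo_iff.mpr ?_
    ext a b
    have h2 : ((2 * c : ℤ) : ZMod 2) = 0 :=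
      (ZMod.intCast_zmod_eq_zero_iff_dvd _ 2).mpr (dvd_mul_right _ _)
    simp only [Matrix.transvection, Matrix.map_apply, Matrix.add_apply, Matrix.one_apply,
      Matrix.single_apply, Int.cast_add, Int.cast_ite, h2, Int.cast_one, Int.cast_zero, ite_self,
      add_zero]
  · intro z
    funext k
    simp only [Matrix.transvection, Matrix.add_mulVec, Matrix.one_mulVec, Pi.add_apply,
      Matrix.single_mulVec]
    by_cases hk : k = i
    · subst hk; simp
    · simp [hk]

theorem exists_levelTwo_neg {r : ℕ} {i j : Fin r} (hij : i ≠ j) :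
    ∃ M ∈ levelTwo r, ∀ z : Fin r → ℤ, z j = 0 →
      (M : Matrix (Fin r) (Fin r) ℤ).mulVec z = Function.update z i (-z i) := by
  refine ⟨⟨Matrix.diagonal fun k => if k = i ∨ k = j then -1 else 1, ?_⟩, ?_, ?_⟩
  · rw [Matrix.det_diagonal, Finset.prod_ite, Finset.prod_const, Finset.prod_const_one, mul_one]
    have : Finset.univ.filter (fun k => k = i ∨ k = j) = {i, j} := by ext; simp
    rw [this, Finset.card_pair hij]
    norm_num
  · refine mem_levelTwo_iff.mpr ?_
    ext a b
    by_cases hab : a = b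
    · subst hab
      have h2 : (-1 : ZMod 2) = 1 := rfl
      by_cases h : a = i ∨ a = j <;> simp [h, h2]
    · simp [hab]
  · intro z hz
    funext k
    simp only [Matrix.mulVec_diagonal]
    by_cases hk : k = i
    · subst hk; simp
    · by_cases hk' : k = j
      · subst hk'; simp [hk, hz]
      · simp [hk, hk']

theorem exists_levelTwo_mulVec_eq_emod {r : ℕ} (hr : 2 ≤ r) {p : Fin r → ℤ} (hp : content p = 1) :
    ∃ M ∈ levelTwo r, (M : Matrix (Fin r) (Fin r) ℤ).mulVec p = fun i => p i % 2 := by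
  set f : (Fin r → ℤ) → ℕ := fun z => ∑ i, (4 * z i - 1).natAbs with hf
  obtain ⟨M, hM, hmin⟩ := (measure fun M : Matrix.SpecialLinearGroup (Fin r) ℤ =>
    f ((M : Matrix (Fin r) (Fin r) ℤ).mulVec p)).wf.has_min
      (levelTwo r : Set (Matrix.SpecialLinearGroup (Fin r) ℤ)) ⟨1, one_mem _⟩
  refine ⟨M, hM, ?_⟩
  set v := (M : Matrix (Fin r) (Fin r) ℤ).mulVec p with hv
  have step : ∀ N ∈ levelTwo r, ∀ i x,
      (N : Matrix (Fin r) (Fin r) ℤ).mulVec v = Function.update v i x →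
      (4 * v i - 1).natAbs ≤ (4 * x - 1).natAbs := by
    intro N hN i x hNx
    by_contra! hlt
    refine hmin (N * M) (mul_mem hN hM) ?_
    change f _ < f _
    rw [Matrix.SpecialLinearGroup.coe_mul, ← Matrix.mulVec_mulVec, ← hv, hNx]
    refine Finset.sum_lt_sum (fun k _ => ?_) ⟨i, Finset.mem_univ i, by simpa using hlt⟩
    by_cases hk : k = i
    · subst hk; simpa using hlt.le
    · simp [hk]
  have hsmall : ∀ i j, v j ≠ 0 → |v i| ≤ |v j| := by
    intro i j hj
    by_cases hij : i = j
    · rw [hij]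
    obtain ⟨N, hN, h⟩ := exists_levelTwo_transvection hij 1
    obtain ⟨N', hN', h'⟩ := exists_levelTwo_transvection hij (-1)
    have := step N hN i _ (h v)
    have := step N' hN' i _ (h' v)
    grind
  obtain ⟨k, hk⟩ : ∃ k, v k ≠ 0 := by
    by_contra! h0
    have : 2 ∣ content p := dvd_content_of_dvd_content_mulVec M
      (dvd_content_iff.mpr fun i => by rw [← hv, h0 i]; exact dvd_zero _)
    omega
  have hone : ∀ i, v i ≠ 0 → |v i| = 1 := by
    intro i hi
    have : (v i).natAbs ∣ content p := dvd_content_of_dvd_content_mulVec M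
      (dvd_content_iff.mpr fun j => by
        rw [← hv]
        by_cases hj : v j = 0
        · rw [hj]; exact dvd_zero _
        · have : (v i).natAbs = (v j).natAbs := by
            have := hsmall i j hj
            have := hsmall j i hi
            grind
          rw [this]
          exact Int.natAbs_dvd.mpr dvd_rfl)
    rw [hp, Nat.dvd_one] at this
    rw [Int.abs_eq_natAbs, this, Nat.cast_one]
  have hnonneg : ∀ i, 0 ≤ v i := by
    intro i
    by_contra! hi
    have hi1 := hone i hi.ne
    rw [abs_of_neg hi] at hi1
    have : Nontrivial (Fin r) := Fin.nontrivial_iff_two_le.mpr hr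
    obtain ⟨j, hj⟩ := exists_ne i
    by_cases hj0 : v j = 0
    · obtain ⟨N, hN, h⟩ := exists_levelTwo_neg hj.symm
      have := step N hN i _ (h v hj0)
      omega
    · obtain ⟨N, hN, h⟩ := exists_levelTwo_transvection hj.symm (v j)
      have := step N hN i _ (h v)
      have hj1 : v j * v j = 1 := by
        rw [← abs_mul_abs_self, hone j hj0, one_mul]
      rw [mul_assoc, hj1] at this
      omega
  funext i
  rw [← mulVec_emod_two hM p i, ← hv]
  have := hnonneg i
  by_cases hi : v i = 0
  · simp [hi]
  · rw [← abs_of_nonneg this, hone i hi]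
    rfl

theorem sum_divisors_moebius (n : ℕ) :
    ∑ e ∈ n.divisors, ArithmeticFunction.moebius e = if n = 1 then 1 else 0 := by
  rw [← ArithmeticFunction.coe_mul_zeta_apply, ArithmeticFunction.moebius_mul_coe_zeta,
    ArithmeticFunction.one_apply]

theorem hasDensity_emod_two_mem {r : ℕ} (T : Set (Fin r → ℤ)) :
    ∃ κ, HasDensity (fun z => T.indicator (1 : (Fin r → ℤ) → ℝ) fun i => z i % 2) κ := by
  classical
  refine ⟨_, (HasDensity.sum ((Fintype.piFinset fun _ : Fin r => ({0, 1} : Finset ℤ)).filter (· ∈ T))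
    fun c hc => hasDensity_emod_two c fun i => ?_).congr fun z => ?_⟩
  · have := Fintype.mem_piFinset.mp (Finset.mem_filter.mp hc).1 i
    simp only [Finset.mem_insert, Finset.mem_singleton] at this
    omega
  · have hz : (fun i => z i % 2) ∈ Fintype.piFinset fun _ : Fin r => ({0, 1} : Finset ℤ) := by
      rw [Fintype.mem_piFinset]
      intro i
      simp only [Finset.mem_insert, Finset.mem_singleton]
      omega
    rw [Finset.sum_ite_eq]
    by_cases h : (fun i => z i % 2) ∈ T <;> simp [Finset.mem_filter, hz, h]

theorem hasDensity_primitive {r : ℕ} (hr : 2 ≤ r) {T : Set (Fin r → ℤ)} (hT : 0 ∉ T) :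
    ∃ κ, HasDensity (fun z => if content z = 1 then
      T.indicator (1 : (Fin r → ℤ) → ℝ) (fun i => z i % 2) else 0) κ := by
  classical
  obtain ⟨κ, hκ⟩ := hasDensity_emod_two_mem T
  have hzero : (fun i => (0 : Fin r → ℤ) i % 2) = 0 := by funext i; simp
  refine ⟨_, (HasDensity.sum_divisors hr
    (w := fun e z => (if e % 2 = 1 then (ArithmeticFunction.moebius e : ℝ) else 0) *
      T.indicator (1 : (Fin r → ℤ) → ℝ) fun i => z i % 2)
    (fun e => hκ.const_mul _) (fun e => ?_) (fun e z => ?_)).congr fun z => ?_⟩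
  · simp only [hzero]
    simp [hT]
  · rw [abs_mul]
    refine mul_le_one₀ ?_ (abs_nonneg _) ?_
    · split_ifs
      · exact_mod_cast ArithmeticFunction.abs_moebius_le_one
      · simp
    · rw [Set.indicator_apply]
      split_ifs <;> simp
  · have hterm : ∀ e ∈ (content z).divisors,
        (if e % 2 = 1 then (ArithmeticFunction.moebius e : ℝ) else 0) *
          T.indicator (1 : (Fin r → ℤ) → ℝ) (fun i => z i / e % 2) =
        (ArithmeticFunction.moebius e : ℝ) *
          T.indicator (1 : (Fin r → ℤ) → ℝ) (fun i => z i % 2) := by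
      intro e he
      have hdvd := dvd_content_iff.mp (Nat.dvd_of_mem_divisors he)
      rcases Nat.mod_two_eq_zero_or_one e with h | h
      · have : (fun i => z i % 2) = 0 := by
          funext i
          exact Int.emod_eq_zero_of_dvd
            (dvd_trans (by exact_mod_cast Nat.dvd_of_mod_eq_zero h) (hdvd i))
        simp [h, this, hT]
      · have : (fun i => z i / e % 2) = fun i => z i % 2 := by
          funext i
          obtain ⟨k, hk⟩ := hdvd i
          have he0 : (e : ℤ) ≠ 0 := by omega
          have he1 : (e : ℤ) % 2 = 1 := by omega
          rw [hk, Int.mul_ediv_cancel_left _ he0, Int.mul_emod, he1]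
          simp
        rw [if_pos h, this]
    rw [Finset.sum_congr rfl hterm, ← Finset.sum_mul, ← Int.cast_sum, sum_divisors_moebius]
    split_ifs <;> simp

theorem mem_iff_content_smul_emod_mem {r : ℕ} (hr : 2 ≤ r) {S : Set (Fin r → ℤ)}
    (hS : ∀ M ∈ levelTwo r, ∀ z ∈ S, (M : Matrix (Fin r) (Fin r) ℤ).mulVec z ∈ S)
    (d : ℕ) {p : Fin r → ℤ} (hp : content p = 1) :
    (d : ℤ) • p ∈ S ↔ ((d : ℤ) • fun i => p i % 2) ∈ S := by
  obtain ⟨M, hM, h⟩ := exists_levelTwo_mulVec_eq_emod hr hp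
  rw [← h, ← Matrix.mulVec_smul]
  refine ⟨hS M hM _, fun hmem => ?_⟩
  have := hS M⁻¹ (inv_mem hM) _ hmem
  rwa [Matrix.mulVec_mulVec, ← Matrix.SpecialLinearGroup.coe_mul, inv_mul_cancel,
    Matrix.SpecialLinearGroup.coe_one, Matrix.one_mulVec] at this

theorem hasDensity_singleton_zero {r : ℕ} (hr : r ≠ 0) :
    HasDensity (fun z : Fin r → ℤ => if z = 0 then 1 else 0) 0 := by
  intro Ω _ _ _
  have h : ∀ t, weightedCount (fun z : Fin r → ℤ => if z = 0 then 1 else 0) Ω t =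
      Ω.indicator 1 0 := by
    intro t
    have h0 : t⁻¹ • realVec (0 : Fin r → ℤ) = 0 := by funext i; simp [realVec]
    rw [weightedCount, tsum_eq_single 0 fun z hz => by simp [hz], h0]
    simp
  simp only [h, zero_mul]
  exact tendsto_const_nhds.div_atTop (tendsto_pow_atTop hr)

theorem exists_hasDensity_of_invariant {r : ℕ} (hr : 2 ≤ r) {S : Set (Fin r → ℤ)}
    (hS : ∀ M ∈ levelTwo r, ∀ z ∈ S, (M : Matrix (Fin r) (Fin r) ℤ).mulVec z ∈ S) :
    ∃ κ, HasDensity (S.indicator 1) κ := by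
  classical
  set T : ℕ → Set (Fin r → ℤ) := fun d => {c | c ≠ 0 ∧ (d : ℤ) • c ∈ S} with hT
  have h0T : ∀ d, 0 ∉ T d := fun d h => h.1 rfl
  choose κ hκ using fun d => hasDensity_primitive hr (h0T d)
  have hc0 : content (0 : Fin r → ℤ) = 0 := content_eq_zero_iff.mpr rfl
  have h1 := HasDensity.sum_divisors hr hκ (fun d => by simp [hc0]) (fun d z => by
    rw [Set.indicator_apply]; split_ifs <;> simp)
  have h2 := (hasDensity_singleton_zero (by omega : r ≠ 0)).const_mul
    (S.indicator (1 : (Fin r → ℤ) → ℝ) 0)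
  refine ⟨_, (h1.add h2).congr fun z => ?_⟩
  by_cases hz : z = 0
  · simp [hz, hc0]
  have hg0 : content z ≠ 0 := content_eq_zero_iff.not.mpr hz
  have hdecomp : ∀ d ∈ (content z).divisors,
      (fun i => (d : ℤ) * (z i / d)) = z := fun d hd =>
    funext fun i => Int.mul_ediv_cancel' (dvd_content_iff.mp (Nat.dvd_of_mem_divisors hd) i)
  have hmul : ∀ d ∈ (content z).divisors, d * content (fun i => z i / d) = content z := by
    intro d hd
    rw [← content_smul, hdecomp d hd]
  have hmem : content z ∈ (content z).divisors := Nat.mem_divisors_self _ hg0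
  have hprim : content (fun i => z i / (content z : ℤ)) = 1 :=
    Nat.eq_of_mul_eq_mul_left (Nat.pos_of_ne_zero hg0) (by rw [hmul _ hmem, mul_one])
  rw [Finset.sum_eq_single (content z)]
  · rw [if_pos hprim, if_neg hz, mul_zero, add_zero]
    have hne : (fun i => z i / (content z : ℤ) % 2) ≠ 0 := by
      intro h
      have : 2 ∣ content (fun i => z i / (content z : ℤ)) :=
        dvd_content_iff.mpr fun i => Int.dvd_of_emod_eq_zero (congrFun h i)
      omega
    have hiff := mem_iff_content_smul_emod_mem hr hS (content z) hprim
    have hz' : ((content z : ℤ) • fun i => z i / (content z : ℤ)) = z := hdecomp _ hmem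
    rw [hz'] at hiff
    simp only [Set.indicator_apply, hT, Set.mem_ofPred_eq, hne, ne_eq, not_false_eq_true, true_and,
      hiff, Pi.one_apply]
  · intro d hd hdne
    rw [if_neg]
    intro h
    have := hmul d hd
    rw [h, mul_one] at this
    exact hdne this
  · exact fun h => absurd hmem h

theorem weightedCount_indicator {r : ℕ} (S : Set (Fin r → ℤ)) {Ω : Set (Fin r → ℝ)}
    (hΩ : Bornology.IsBounded Ω) {t : ℝ} (ht : 0 < t) :
    weightedCount (S.indicator 1) Ω t =
      {z : Fin r → ℤ | z ∈ S ∧ (fun i => (z i : ℝ)) ∈ t • Ω}.ncard := by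
  classical
  have hset : {z : Fin r → ℤ | z ∈ S ∧ (fun i => (z i : ℝ)) ∈ t • Ω} =
      {z | z ∈ S ∧ t⁻¹ • realVec z ∈ Ω} := by
    ext z
    simp only [Set.mem_ofPred_eq, Set.mem_smul_set_iff_inv_smul_mem₀ ht.ne']
    rfl
  have hfin : {z : Fin r → ℤ | z ∈ S ∧ t⁻¹ • realVec z ∈ Ω}.Finite :=
    (finite_setOf_mem hΩ ht).subset fun z hz => hz.2
  rw [hset, Set.ncard_eq_toFinset_card _ hfin, weightedCount, tsum_eq_sum (s := hfin.toFinset)]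
  · rw [Finset.sum_congr rfl (g := fun _ => (1 : ℝ))]
    · simp
    · intro z hz
      have := hfin.mem_toFinset.mp hz
      simp [this.1, this.2]
  · intro z hz
    have : ¬(z ∈ S ∧ t⁻¹ • realVec z ∈ Ω) := fun h => hz (hfin.mem_toFinset.mpr h)
    by_cases h1 : z ∈ S
    · have h2 : t⁻¹ • realVec z ∉ Ω := fun h => this ⟨h1, h⟩
      simp [h2]
    · simp [h1]

theorem mem_smul_closedBall_iff {r n : ℕ} (hn : 0 < n) (z : Fin r → ℤ) :
    (fun i => (z i : ℝ)) ∈ (n : ℝ) • Metric.closedBall (0 : Fin r → ℝ) 1 ↔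
      ∀ i, |z i| ≤ (n : ℤ) := by
  have hn' : (0 : ℝ) < n := by exact_mod_cast hn
  rw [smul_unitClosedBall, mem_closedBall_zero_iff, pi_norm_le_iff_of_nonneg (norm_nonneg _)]
  refine forall_congr' fun i => ?_
  rw [Real.norm_eq_abs, Real.norm_eq_abs, abs_of_pos hn']
  exact_mod_cast Iff.rfl

theorem HasDensity.tendsto_ncard_cube {r : ℕ} {S : Set (Fin r → ℤ)} {κ : ℝ}
    (h : HasDensity (S.indicator 1) κ) :
    Tendsto (fun n : ℕ => ({z : Fin r → ℤ | z ∈ S ∧ ∀ i, |z i| ≤ (n : ℤ)}.ncard : ℝ) / (n : ℝ) ^ r)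
      atTop (nhds (κ *
        (MeasureTheory.volume (Metric.closedBall (0 : Fin r → ℝ) 1)).toReal)) := by
  have := (h _ Metric.isBounded_closedBall Metric.isClosed_closedBall.measurableSet
    ((convex_closedBall (0 : Fin r → ℝ) 1).addHaar_frontier _)).comp
    tendsto_natCast_atTop_atTop
  refine this.congr' ?_
  filter_upwards [eventually_gt_atTop 0] with n hn
  simp only [Function.comp]
  rw [weightedCount_indicator S Metric.isBounded_closedBall (Nat.cast_pos.mpr hn)]
  simp only [mem_smul_closedBall_iff hn]

theorem hasDensity_univ {r : ℕ} :
    HasDensity ((Set.univ : Set (Fin r → ℤ)).indicator 1) 1 := by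
  intro Ω h1 h2 h3
  rw [one_mul]
  refine ((tendsto_tsum_indicator_shifted_lattice 0 h1 h2 h3).comp
    tendsto_inv_atTop_nhdsGT_zero).congr fun t => ?_
  simp [weightedCount, div_eq_mul_inv]

/-- Let `r ≥ 2` and let `S ⊆ ℤ^r` be invariant under the subgroup `G_r` of `SL(r,ℤ)`
consisting of matrices congruent to the identity modulo 2. Suppose the strict asymptotic
density `δ` of `S` with respect to the sup-norm exists. Then for every bounded open set
`Ω ⊆ ℝ^r` whose boundary has Lebesgue measure zero,
`#(S ∩ tΩ)/t^r → δ·λ(Ω)` as the real number `t → ∞`. -/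
theorem stmt_8 (r : ℕ) (hr : 2 ≤ r) (S : Set (Fin r → ℤ))
    (hSinv : ∀ M : Matrix.SpecialLinearGroup (Fin r) ℤ,
      Matrix.SpecialLinearGroup.map (Int.castRingHom (ZMod 2)) M = 1 →
      ∀ z ∈ S, (M : Matrix (Fin r) (Fin r) ℤ).mulVec z ∈ S)
    (δ : ℝ)
    (hδ : Tendsto (fun n : ℕ =>
        (({z : Fin r → ℤ | z ∈ S ∧ ∀ i, |z i| ≤ (n : ℤ)}.ncard : ℝ)) /
          ({z : Fin r → ℤ | ∀ i, |z i| ≤ (n : ℤ)}.ncard : ℝ))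
      atTop (nhds δ))
    (Ω : Set (Fin r → ℝ)) (hΩopen : IsOpen Ω) (hΩbdd : Bornology.IsBounded Ω)
    (hΩfr : MeasureTheory.volume (frontier Ω) = 0) :
    Tendsto (fun t : ℝ =>
      ({z : Fin r → ℤ | z ∈ S ∧ (fun i => (z i : ℝ)) ∈ t • Ω}.ncard : ℝ) / t ^ r)
      atTop (nhds (δ * (MeasureTheory.volume Ω).toReal)) := by
  obtain ⟨κ, hκ⟩ := exists_hasDensity_of_invariant hr hSinv
  have hball : 0 < (MeasureTheory.volume (Metric.closedBall (0 : Fin r → ℝ) 1)).toReal :=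
    ENNReal.toReal_pos (Metric.measure_closedBall_pos _ _ one_pos).ne'
      MeasureTheory.measure_closedBall_lt_top.ne
  have hδκ : δ = κ := by
    have hquot := hκ.tendsto_ncard_cube.div hasDensity_univ.tendsto_ncard_cube
      (by rw [one_mul]; exact hball.ne')
    rw [one_mul, mul_div_cancel_right₀ _ hball.ne'] at hquot
    refine tendsto_nhds_unique hδ (hquot.congr' ?_)
    filter_upwards [eventually_gt_atTop 0] with n hn
    have hn' : (n : ℝ) ^ r ≠ 0 := by positivity
    simp only [Pi.div_apply, Set.mem_univ, true_and]
    rw [div_div_div_cancel_right₀ hn']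
  rw [hδκ]
  refine (hκ Ω hΩbdd hΩopen.measurableSet hΩfr).congr' ?_
  filter_upwards [eventually_gt_atTop 0] with t ht
  rw [weightedCount_indicator S hΩbdd ht]
end
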